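/- arXiv:1811.05428 — 2 statements merged into one kernel-verified Lean document; each statement's English description precedes it below -/
import Mathlib

section
/- Let λ, μ be positive real numbers. The differentiation map f ↦ f′ is bounded from H^{(λ)} to H^{(μ)} (i.e., there exists C > 0 such that every f ∈ H^{(λ)} has f′ ∈ H^{(μ)} with ‖f′‖_{H^{(μ)}} ≤ C‖f‖_{H^{(λ)}}) if and only if μ − λ ≥ 2. -/
open Metric

/-- The Pochhammer symbol `(l)ₙ = l (l+1) ⋯ (l+n−1)`. -/
noncomputable def poch (l : ℝ) (n : ℕ) : ℝ := ∏ i ∈ Finset.range n, (l + i)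

/-- The weight `n! / (l)ₙ`, i.e. `‖zⁿ‖²` in the space `H^{(l)}` with kernel `(1 - z w̄)^{-l}`. -/
noncomputable def wt (l : ℝ) (n : ℕ) : ℝ := (Nat.factorial n : ℝ) / poch l n

theorem poch_succ (l : ℝ) (n : ℕ) : poch l (n + 1) = poch l n * (l + n) := by
  simp [poch, Finset.prod_range_succ]

theorem poch_pos {l : ℝ} (hl : 0 < l) (n : ℕ) : 0 < poch l n :=
  Finset.prod_pos fun i _ => by positivity

theorem wt_pos {l : ℝ} (hl : 0 < l) (n : ℕ) : 0 < wt l n :=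
  div_pos (by positivity) (poch_pos hl n)

theorem poch_mono {l m : ℝ} (hl : 0 < l) (h : l ≤ m) (n : ℕ) : poch l n ≤ poch m n :=
  Finset.prod_le_prod (fun i _ => by positivity) fun i _ => by linarith

/-- The shift identity `(l)ₙ₊₁ (l + n + 1) = l (l + 1) (l + 2)ₙ`. -/
theorem poch_succ_mul (l : ℝ) (n : ℕ) :
    poch l (n + 1) * (l + n + 1) = l * (l + 1) * poch (l + 2) n := by
  induction n with
  | zero => simp [poch]
  | succ n ih =>
    rw [poch_succ, poch_succ (l + 2)]
    push_cast
    linear_combination (l + 2 + n) * ih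

/-- The weight comparison defining boundedness of differentiation, in terms of Pochhammer
symbols. -/
theorem sq_mul_wt_le_iff {l m : ℝ} (hl : 0 < l) (hm : 0 < m) (C : ℝ) (n : ℕ) :
    ((n : ℝ) + 1) ^ 2 * wt m n ≤ C * wt l (n + 1) ↔
      ((n : ℝ) + 1) * poch l (n + 1) ≤ C * poch m n := by
  have h1 := poch_pos hm n
  have h2 := poch_pos hl (n + 1)
  have h3 : (0 : ℝ) < Nat.factorial n * (n + 1) := by positivity
  rw [wt, wt, Nat.factorial_succ, ← mul_div_assoc, ← mul_div_assoc, div_le_div_iff₀ h1 h2,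
    ← mul_le_mul_iff_right₀ (b := ((n : ℝ) + 1) * poch l (n + 1)) h3]
  push_cast
  ring_nf

theorem poch_mul_one_add_sum_le {m d : ℝ} (hm : 0 < m) (hd : 0 ≤ d) (n : ℕ) :
    poch m n * (1 + ∑ i ∈ Finset.range n, d / (m + i)) ≤ poch (m + d) n := by
  induction n with
  | zero => simp [poch]
  | succ n ih =>
    rw [poch_succ, poch_succ, Finset.sum_range_succ]
    have hmn : 0 < m + n := by positivity
    have hp := poch_pos hm n
    have hmono := poch_mono hm (le_add_of_nonneg_right hd) n
    calc poch m n * (m + n) * (1 + (∑ i ∈ Finset.range n, d / (m + i) + d / (m + n)))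
        = poch m n * (1 + ∑ i ∈ Finset.range n, d / (m + i)) * (m + n) + poch m n * d := by
          field_simp
          ring
      _ ≤ poch (m + d) n * (m + n) + poch (m + d) n * d := by gcongr
      _ = poch (m + d) n * (m + d + n) := by ring

theorem exists_mul_poch_lt_poch {m d : ℝ} (hm : 0 < m) (hd : 0 < d) (K : ℝ) :
    ∃ n, K * poch m n < poch (m + d) n := by
  obtain ⟨n, hn⟩ := (Real.tendsto_sum_range_one_div_nat_succ_atTop.eventually_ge_atTop
    (K * ((m + 1) / d))).exists
  refine ⟨n, lt_of_lt_of_le ?_ (poch_mul_one_add_sum_le hm hd.le n)⟩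
  have hsum : d / (m + 1) * ∑ i ∈ Finset.range n, 1 / ((i : ℝ) + 1) ≤
      ∑ i ∈ Finset.range n, d / (m + i) := by
    rw [Finset.mul_sum]
    refine Finset.sum_le_sum fun i _ => ?_
    rw [div_mul_div_comm, mul_one]
    gcongr
    nlinarith [mul_nonneg hm.le (Nat.cast_nonneg (α := ℝ) i)]
  have hK : K ≤ d / (m + 1) * ∑ i ∈ Finset.range n, 1 / ((i : ℝ) + 1) := by
    calc K = d / (m + 1) * (K * ((m + 1) / d)) := by field_simp
      _ ≤ _ := by gcongr
  rw [mul_comm]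
  exact mul_lt_mul_of_pos_left (by linarith) (poch_pos hm n)

/-- Let `λ, μ > 0`. The differentiation map `f ↦ f′` is bounded from `H^{(λ)}`
to `H^{(μ)}` (i.e. there is `C > 0` such that every `f(z) = Σ αₙ zⁿ` in `H^{(λ)}` has
`f′ ∈ H^{(μ)}` with `‖f′‖²_{H^{(μ)}} ≤ C² ‖f‖²_{H^{(λ)}}`) if and only if `μ − λ ≥ 2`. -/
theorem stmt_6 (l m : ℝ) (hl : 0 < l) (hm : 0 < m) :
    (∃ C : ℝ, 0 < C ∧ ∀ (f : ℂ → ℂ) (α : ℕ → ℂ),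
      (∀ z ∈ ball (0 : ℂ) 1, HasSum (fun n => α n * z ^ n) (f z)) →
      Summable (fun n => ‖α n‖ ^ 2 * wt l n) →
      Summable (fun n : ℕ => ((n : ℝ) + 1) ^ 2 * ‖α (n + 1)‖ ^ 2 * wt m n) ∧
      ∑' n : ℕ, ((n : ℝ) + 1) ^ 2 * ‖α (n + 1)‖ ^ 2 * wt m n ≤
        C ^ 2 * ∑' n, ‖α n‖ ^ 2 * wt l n) ↔
    2 ≤ m - l := by
  constructor
  · rintro ⟨C, -, hC⟩
    by_contra! hlt
    obtain ⟨n, hn⟩ := exists_mul_poch_lt_poch hm (show 0 < l + 2 - m by linarith) (C ^ 2 / l)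
    rw [add_sub_cancel] at hn
    have hmono : ((n : ℝ) + 1) ^ 2 * wt m n ≤ C ^ 2 * wt l (n + 1) := by
      have hα (k : ℕ) (hk : k ≠ n + 1) : (Pi.single (n + 1) 1 : ℕ → ℂ) k = 0 :=
        Pi.single_eq_of_ne hk 1
      have hs : HasSum (fun k => ‖(Pi.single (n + 1) 1 : ℕ → ℂ) k‖ ^ 2 * wt l k)
          (wt l (n + 1)) := by
        convert hasSum_single (n + 1) fun k hk => ?_ using 1
        · simp
        · simp [hα k hk]
      have hs' : HasSum (fun k : ℕ => ((k : ℝ) + 1) ^ 2 *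
          ‖(Pi.single (n + 1) 1 : ℕ → ℂ) (k + 1)‖ ^ 2 * wt m k)
          (((n : ℝ) + 1) ^ 2 * wt m n) := by
        convert hasSum_single n fun k hk => ?_ using 1
        · simp
        · simp [hα (k + 1) (by simpa using hk)]
      have key := (hC (fun z => z ^ (n + 1)) (Pi.single (n + 1) 1) (fun z _ => by
        convert hasSum_single (n + 1) fun k hk => ?_ using 1
        · simp
        · simp [hα k hk]) hs.summable).2
      rwa [hs.tsum_eq, hs'.tsum_eq] at key
    rw [sq_mul_wt_le_iff hl hm] at hmono
    have hshift := poch_succ_mul l n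
    have hp := poch_pos hl (n + 1)
    have hln : l + n + 1 ≤ (l + 1) * (n + 1) := by
      nlinarith [mul_nonneg hl.le (Nat.cast_nonneg (α := ℝ) n)]
    have hle : (l + 1) * (l * poch (l + 2) n) ≤ (l + 1) * (C ^ 2 * poch m n) := by
      calc (l + 1) * (l * poch (l + 2) n) = poch l (n + 1) * (l + n + 1) := by
            rw [hshift]; ring
        _ ≤ poch l (n + 1) * ((l + 1) * (n + 1)) := by gcongr
        _ = (l + 1) * ((n + 1) * poch l (n + 1)) := by ring
        _ ≤ _ := by gcongr
    have hle' := le_of_mul_le_mul_left hle (by positivity)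
    rw [div_mul_eq_mul_div, div_lt_iff₀ hl] at hn
    linarith
  · intro h
    refine ⟨√(l * (l + 1)), by positivity, fun f α _ hs => ?_⟩
    rw [Real.sq_sqrt (by positivity)]
    have hw (n : ℕ) : ((n : ℝ) + 1) ^ 2 * wt m n ≤ l * (l + 1) * wt l (n + 1) := by
      rw [sq_mul_wt_le_iff hl hm]
      have hp := poch_pos hl (n + 1)
      calc ((n : ℝ) + 1) * poch l (n + 1) ≤ poch l (n + 1) * (l + n + 1) := by
            rw [mul_comm]
            gcongr
            linarith
        _ = l * (l + 1) * poch (l + 2) n := poch_succ_mul l n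
        _ ≤ _ := by
            gcongr
            exact poch_mono (by linarith) (by linarith) n
    have hterm (n : ℕ) : ((n : ℝ) + 1) ^ 2 * ‖α (n + 1)‖ ^ 2 * wt m n ≤
        l * (l + 1) * (‖α (n + 1)‖ ^ 2 * wt l (n + 1)) := by
      nlinarith [mul_le_mul_of_nonneg_left (hw n) (sq_nonneg ‖α (n + 1)‖)]
    have hs1 := (summable_nat_add_iff 1).2 hs
    have hs2 : Summable fun n : ℕ => ((n : ℝ) + 1) ^ 2 * ‖α (n + 1)‖ ^ 2 * wt m n :=
      .of_nonneg_of_le (fun n => mul_nonneg (by positivity) (wt_pos hm n).le) hterm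
        (hs1.mul_left (l * (l + 1)))
    refine ⟨hs2, (hs2.tsum_le_tsum hterm (hs1.mul_left _)).trans ?_⟩
    rw [tsum_mul_left, hs.tsum_eq_zero_add]
    gcongr
    exact le_add_of_nonneg_left (mul_nonneg (by positivity) (wt_pos hl 0).le)
end

section
/- Let (bₙ)_{n≥0} be a decreasing sequence of positive real numbers such that Σ bₙ xⁿ converges for every x ∈ [0,1) and sup_n bₙ/b_{n+1} < ∞. Suppose the multiplication operator M_z on H(b) is Möbius bounded, i.e., there exists c > 0 such that for every θ ∈ [0,2π), a ∈ 𝔻 and f ∈ H(b), the product φ_{θ,a}·f belongs to H(b) with ‖φ_{θ,a} f‖_{H(b)} ≤ c ‖f‖_{H(b)}. Then there exists a constant c′ > 0 such that b_j / b_{n+j} ≤ c′(n+1) for all n, j ≥ 0; equivalently, ‖M_zⁿ‖ ≤ √(c′)·(n+1)^{1/2} for all n ≥ 0. -/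
open Metric

/-- The Möbius transformation `φ_{θ,a}(z) = e^{iθ} (z − a)/(1 − ā z)`. -/
noncomputable def mobius (θ : ℝ) (a z : ℂ) : ℂ :=
  Complex.exp (θ * Complex.I) * (z - a) / (1 - (starRingEnd ℂ) a * z)

/-- The multiplication operator `M_z` on the weighted Hardy space `H(b)` (with
`‖Σ αₙ zⁿ‖² = Σ |αₙ|²/bₙ`) is Möbius bounded: there is a single constant `c > 0` bounding the
norm of the multiplication operator `M_{φ_{θ,a}}` on `H(b)` for every `φ_{θ,a} ∈ Möb`. -/
def MobiusBounded (b : ℕ → ℝ) : Prop :=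
  ∃ c : ℝ, 0 < c ∧ ∀ θ ∈ Set.Ico (0 : ℝ) (2 * Real.pi), ∀ a ∈ ball (0 : ℂ) 1,
    ∀ (f : ℂ → ℂ) (α : ℕ → ℂ),
      (∀ z ∈ ball (0 : ℂ) 1, HasSum (fun n => α n * z ^ n) (f z)) →
      Summable (fun n => ‖α n‖ ^ 2 / b n) →
      ∃ β : ℕ → ℂ,
        (∀ z ∈ ball (0 : ℂ) 1, HasSum (fun n => β n * z ^ n) (mobius θ a z * f z)) ∧
        Summable (fun n => ‖β n‖ ^ 2 / b n) ∧
        ∑' n, ‖β n‖ ^ 2 / b n ≤ c ^ 2 * ∑' n, ‖α n‖ ^ 2 / b n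

open Filter Topology in
theorem coeff_eq_of_hasSum_ball {α β : ℕ → ℂ} {f : ℂ → ℂ}
    (hα : ∀ z ∈ ball (0 : ℂ) 1, HasSum (fun n => α n * z ^ n) (f z))
    (hβ : ∀ z ∈ ball (0 : ℂ) 1, HasSum (fun n => β n * z ^ n) (f z)) : α = β := by
  have key : ∀ γ : ℕ → ℂ, (∀ z ∈ ball (0 : ℂ) 1, HasSum (fun n => γ n * z ^ n) (f z)) →
      HasFPowerSeriesAt f (FormalMultilinearSeries.ofScalars ℂ γ) 0 := by
    intro γ hγ
    rw [hasFPowerSeriesAt_iff]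
    filter_upwards [ball_mem_nhds (0 : ℂ) one_pos] with z hz
    simpa [mul_comm] using hγ z hz
  have h := (key α hα).eq_formalMultilinearSeries (key β hβ)
  funext n
  simpa using congrArg (fun p => p.coeff n) h

/-- The Taylor coefficients at `0` of `φ_{0,a}(z) z^j`, for real `a`. -/
noncomputable def mobiusCoeff (a : ℝ) (j m : ℕ) : ℂ :=
  if m < j then 0 else if m = j then -(a : ℂ) else (1 - (a : ℂ) ^ 2) * (a : ℂ) ^ (m - (j + 1))

theorem mobiusCoeff_add (a : ℝ) (j k : ℕ) :
    mobiusCoeff a j (k + (j + 1)) = (1 - (a : ℂ) ^ 2) * (a : ℂ) ^ k := by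
  have h₁ : ¬ k + (j + 1) < j := by omega
  have h₂ : k + (j + 1) ≠ j := by omega
  simp [mobiusCoeff, h₁, h₂]

theorem hasSum_mobiusCoeff {a : ℝ} (ha₀ : 0 ≤ a) (ha₁ : a < 1) (j : ℕ) {z : ℂ}
    (hz : z ∈ ball (0 : ℂ) 1) :
    HasSum (fun n => mobiusCoeff a j n * z ^ n) (mobius 0 a z * z ^ j) := by
  have hz' : ‖z‖ < 1 := by simpa using hz
  have haz : ‖(a : ℂ) * z‖ < 1 := by
    rw [norm_mul, Complex.norm_real, Real.norm_of_nonneg ha₀]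
    nlinarith [norm_nonneg z]
  have hne : 1 - (a : ℂ) * z ≠ 0 := fun h => by
    rw [← sub_eq_zero.mp h, norm_one] at haz
    exact lt_irrefl _ haz
  have hlow : ∑ i ∈ Finset.range (j + 1), mobiusCoeff a j i * z ^ i = -(a : ℂ) * z ^ j := by
    rw [Finset.sum_range_succ, Finset.sum_eq_zero]
    · simp [mobiusCoeff]
    · intro i hi
      simp [mobiusCoeff, Finset.mem_range.mp hi]
  have htail : HasSum (fun k => mobiusCoeff a j (k + (j + 1)) * z ^ (k + (j + 1)))
      ((1 - (a : ℂ) ^ 2) * z ^ (j + 1) * (1 - (a : ℂ) * z)⁻¹) := by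
    refine ((hasSum_geometric_of_norm_lt_one haz).mul_left
      ((1 - (a : ℂ) ^ 2) * z ^ (j + 1))).congr_fun ?_
    intro k
    rw [mobiusCoeff_add]
    ring
  have h := (hasSum_nat_add_iff (f := fun n => mobiusCoeff a j n * z ^ n) (j + 1)).mp htail
  rw [hlow] at h
  suffices heq : mobius 0 a z * z ^ j = (1 - (a : ℂ) ^ 2) * z ^ (j + 1) * (1 - (a : ℂ) * z)⁻¹
      + -(a : ℂ) * z ^ j by rwa [heq]
  simp only [mobius, Complex.ofReal_zero, zero_mul, Complex.exp_zero, Complex.conj_ofReal]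
  linear_combination (-(a : ℂ) * z ^ j) * mul_inv_cancel₀ hne

/-- Testing Möbius boundedness on the monomial `z^j`. -/
theorem MobiusBounded.exists_sum_le {b : ℕ → ℝ} (hb : ∀ n, 0 < b n) (h : MobiusBounded b) :
    ∃ c : ℝ, 0 < c ∧ ∀ a : ℝ, 0 ≤ a → a < 1 → ∀ (j : ℕ) (s : Finset ℕ),
      ∑ k ∈ s, ((1 - a ^ 2) * a ^ k) ^ 2 / b (k + (j + 1)) ≤ c ^ 2 / b j := by
  obtain ⟨c, hc, H⟩ := h
  refine ⟨c, hc, fun a ha₀ ha₁ j s => ?_⟩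
  have hball : (a : ℂ) ∈ ball (0 : ℂ) 1 := by
    simpa [abs_of_nonneg ha₀] using ha₁
  have hnorm : HasSum (fun n => ‖(Pi.single j 1 : ℕ → ℂ) n‖ ^ 2 / b n) (1 / b j) := by
    convert hasSum_single (f := fun n => ‖(Pi.single j 1 : ℕ → ℂ) n‖ ^ 2 / b n) j ?_ using 1
    · simp
    · intro n hn
      simp [hn]
  obtain ⟨β, hβ, hβs, hle⟩ := H 0 ⟨le_rfl, by positivity⟩ a hball (fun z => z ^ j)
    (Pi.single j 1) (fun z _ => by
      convert hasSum_single (f := fun n => (Pi.single j 1 : ℕ → ℂ) n * z ^ n) j ?_ using 1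
      · simp
      · intro n hn
        simp [hn]) hnorm.summable
  obtain rfl : β = mobiusCoeff a j :=
    coeff_eq_of_hasSum_ball hβ fun z hz => hasSum_mobiusCoeff ha₀ ha₁ j hz
  rw [hnorm.tsum_eq, mul_one_div] at hle
  have hterm : ∀ k, ((1 - a ^ 2) * a ^ k) ^ 2 / b (k + (j + 1))
      = ‖mobiusCoeff a j (k + (j + 1))‖ ^ 2 / b (k + (j + 1)) := by
    intro k
    rw [mobiusCoeff_add, ← Complex.ofReal_one, ← Complex.ofReal_pow, ← Complex.ofReal_sub,
      ← Complex.ofReal_pow, ← Complex.ofReal_mul, Complex.norm_real, Real.norm_eq_abs, sq_abs]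
  calc ∑ k ∈ s, ((1 - a ^ 2) * a ^ k) ^ 2 / b (k + (j + 1))
      = ∑ m ∈ s.map (addRightEmbedding (j + 1)), ‖mobiusCoeff a j m‖ ^ 2 / b m := by
        simp [hterm]
    _ ≤ ∑' m, ‖mobiusCoeff a j m‖ ^ 2 / b m :=
        hβs.sum_le_tsum _ fun m _ => div_nonneg (sq_nonneg _) (hb m).le
    _ ≤ c ^ 2 / b j := hle

/-- If `(bₙ)` is a decreasing sequence of positive reals with `Σ bₙ xⁿ < ∞` on
`[0,1)` and `sup bₙ/b_{n+1} < ∞`, and `M_z` on `H(b)` is Möbius bounded, then there is `c′ > 0`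
with `b_j / b_{n+j} ≤ c′ (n+1)` for all `n, j ≥ 0` (i.e. `‖M_zⁿ‖ ≤ √c′ (n+1)^{1/2}`). -/
theorem stmt_10 (b : ℕ → ℝ) (hb : ∀ n, 0 < b n) (hdec : ∀ n, b (n + 1) ≤ b n)
    (hconv : ∀ x ∈ Set.Ico (0 : ℝ) 1, Summable (fun n => b n * x ^ n))
    (hshift : ∃ M : ℝ, ∀ n, b n / b (n + 1) ≤ M)
    (hmob : MobiusBounded b) :
    ∃ c' : ℝ, 0 < c' ∧ ∀ n j : ℕ, b j / b (n + j) ≤ c' * ((n : ℝ) + 1) := by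
  obtain ⟨c, hc, H⟩ := hmob.exists_sum_le hb
  refine ⟨128 * c ^ 2, by positivity, fun n j => ?_⟩
  have hN : (0 : ℝ) < (n : ℝ) + 1 := by positivity
  set ε : ℝ := 1 / (8 * ((n : ℝ) + 1)) with hε
  have hε₀ : 0 < ε := by positivity
  have hεN : ε * ((n : ℝ) + 1) = 1 / 8 := by rw [hε]; field_simp
  have hε₁ : ε ≤ 1 / 8 := by
    have : (0 : ℝ) ≤ n := n.cast_nonneg
    nlinarith
  have hterm : ∀ k ∈ Finset.Ico (n + 1) (2 * (n + 1)),
      ε ^ 2 / 2 / b (n + j) ≤ ((1 - (1 - ε) ^ 2) * (1 - ε) ^ k) ^ 2 / b (k + (j + 1)) := by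
    intro k hk
    obtain ⟨hk₁, hk₂⟩ := Finset.mem_Ico.mp hk
    have hbk : b (k + (j + 1)) ≤ b (n + j) := antitone_nat_of_succ_le hdec (by omega)
    have hkN : ((k : ℕ) : ℝ) ≤ 2 * ((n : ℝ) + 1) := by exact_mod_cast hk₂.le
    have hbern : (1 : ℝ) / 2 ≤ ((1 - ε) ^ k) ^ 2 := by
      have h := one_add_mul_le_pow (a := -ε) (by linarith) (k * 2)
      rw [← pow_mul, sub_eq_add_neg]
      refine le_trans ?_ h
      push_cast
      nlinarith
    have hone : ε ^ 2 ≤ (1 - (1 - ε) ^ 2) ^ 2 := by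
      apply pow_le_pow_left₀ hε₀.le
      nlinarith
    apply div_le_div₀ (sq_nonneg _) _ (hb _) hbk
    rw [mul_pow, div_eq_mul_one_div]
    exact mul_le_mul hone hbern (by norm_num) (sq_nonneg _)
  have hsum := (Finset.card_nsmul_le_sum _ _ _ hterm).trans
    (H (1 - ε) (by linarith) (by linarith) j _)
  have hcard : (Finset.Ico (n + 1) (2 * (n + 1))).card = n + 1 := by
    rw [Nat.card_Ico]; omega
  rw [hcard, nsmul_eq_mul, Nat.cast_add_one] at hsum
  have hb₁ := hb (n + j)
  have hb₂ := hb j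
  have hlhs : ((n : ℝ) + 1) * (ε ^ 2 / 2 / b (n + j)) = 1 / (128 * ((n : ℝ) + 1) * b (n + j)) := by
    rw [hε]
    field_simp
    norm_num
  rw [hlhs, div_le_div_iff₀ (by positivity) hb₂] at hsum
  rw [div_le_iff₀ hb₁]
  linarith
end
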